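/- Let Ω ⊂ ℝ³ be a bounded open set with Lipschitz boundary, d(x) := dist(x, ∂Ω) (defined for all x ∈ ℝ³), let 1 < p < ∞ and α ∈ ℝ. Then the weight w(x) = d(x)^α satisfies the Muckenhoupt A_p condition — i.e., there exists C such that for every cube Q ⊂ ℝ³, (⨍_Q w dx) · (⨍_Q w^{−1/(p−1)} dx)^{p−1} ≤ C — if and only if −1 < α < p − 1. -/

import Mathlib

noncomputable section

open MeasureTheory Real Filter Topology Bornology ENNReal NNReal

/-- Euclidean 3-space. -/
abbrev E3 : Type := EuclideanSpace ℝ (Fin 3)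

/-- Euclidean 2-space. -/
abbrev E2 : Type := EuclideanSpace ℝ (Fin 2)

/-- The `i`-th standard basis vector of `E3`. -/
def ee (i : Fin 3) : E3 := EuclideanSpace.single i 1

/-- Partial derivative `∂ᵢ f` of a scalar function. -/
def pds (f : E3 → ℝ) (i : Fin 3) (x : E3) : ℝ := fderiv ℝ f x (ee i)

/-- Partial derivative `∂ᵢ vⱼ` of a vector field. -/
def pd (v : E3 → E3) (i j : Fin 3) (x : E3) : ℝ := fderiv ℝ v x (ee i) j

/-- Build a vector of `E3` from coordinates. -/
def mk3 (a b c : ℝ) : E3 := (WithLp.equiv 2 (Fin 3 → ℝ)).symm ![a, b, c]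

/-- Build a vector of `E2` from coordinates. -/
def mk2 (a b : ℝ) : E2 := (WithLp.equiv 2 (Fin 2 → ℝ)).symm ![a, b]

/-- First two coordinates `x'` of a point of `E3`. -/
def proj12 (y : E3) : E2 := mk2 (y 0) (y 1)

/-- Gradient of a scalar function, as a vector field. -/
def grad3 (f : E3 → ℝ) (x : E3) : E3 := mk3 (pds f 0 x) (pds f 1 x) (pds f 2 x)

/-- Gradient matrix `(∇v)ᵢⱼ = ∂ᵢ vⱼ` of a vector field. -/
def gradv (v : E3 → E3) (x : E3) (i j : Fin 3) : ℝ := pd v i j x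

/-- Divergence of a vector field. -/
def vdiv (v : E3 → E3) (x : E3) : ℝ := ∑ i, pd v i i x

/-- Curl `∇ × v` of a vector field. -/
def vcurl (v : E3 → E3) (x : E3) : E3 :=
  mk3 (pd v 1 2 x - pd v 2 1 x) (pd v 2 0 x - pd v 0 2 x) (pd v 0 1 x - pd v 1 0 x)

/-- Curl computed from a (weak) gradient matrix `G`, `(curl v)₁ = G₂₃ - G₃₂` etc. -/
def curlOf (G : E3 → Fin 3 → Fin 3 → ℝ) (x : E3) : E3 :=
  mk3 (G x 1 2 - G x 2 1) (G x 2 0 - G x 0 2) (G x 0 1 - G x 1 0)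

/-- Divergence computed from a (weak) gradient matrix. -/
def divOf (G : E3 → Fin 3 → Fin 3 → ℝ) (x : E3) : ℝ := ∑ i, G x i i

/-- Cross product on `E3`. -/
def cross3 (a b : E3) : E3 :=
  mk3 (a 1 * b 2 - a 2 * b 1) (a 2 * b 0 - a 0 * b 2) (a 0 * b 1 - a 1 * b 0)

/-- Euclidean dot product on `E3`. -/
def dot3 (a b : E3) : ℝ := ∑ i, a i * b i

/-- Frobenius (double-dot) product of two 3×3 matrices. -/
def mdot (A B : Fin 3 → Fin 3 → ℝ) : ℝ := ∑ i, ∑ j, A i j * B i j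

/-- Frobenius (Euclidean) norm of a 3×3 matrix. -/
def frob (M : Fin 3 → Fin 3 → ℝ) : ℝ := Real.sqrt (∑ i, ∑ j, (M i j) ^ 2)

/-- Symmetric part of a 3×3 matrix. -/
def symm3 (M : Fin 3 → Fin 3 → ℝ) (i j : Fin 3) : ℝ := (M i j + M j i) / 2

/-- Distance to the boundary of `Ω`. -/
def dB (Ω : Set E3) (x : E3) : ℝ := Metric.infDist x (frontier Ω)

/-- Scalar test functions: smooth compactly supported inside `Ω`. -/
structure IsTestS (Ω : Set E3) (ψ : E3 → ℝ) : Prop where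
  smooth : ContDiff ℝ (⊤ : ℕ∞) ψ
  compsupp : HasCompactSupport ψ
  suppin : tsupport ψ ⊆ Ω

/-- Vector test functions: smooth compactly supported inside `Ω`. -/
structure IsTest (Ω : Set E3) (φ : E3 → E3) : Prop where
  smooth : ContDiff ℝ (⊤ : ℕ∞) φ
  compsupp : HasCompactSupport φ
  suppin : tsupport φ ⊆ Ω

/-- Solenoidal (divergence-free) vector test functions `C^∞_{0,σ}(Ω)`. -/
structure IsTestSol (Ω : Set E3) (φ : E3 → E3) extends IsTest Ω φ : Prop where
  sol : ∀ x, vdiv φ x = 0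

/-- `G` is the distributional gradient of the vector field `v` on `Ω`. -/
def HasWeakGrad (Ω : Set E3) (v : E3 → E3) (G : E3 → Fin 3 → Fin 3 → ℝ) : Prop :=
  ∀ ψ : E3 → ℝ, IsTestS Ω ψ → ∀ i j,
    ∫ x in Ω, v x j * pds ψ i x = - ∫ x in Ω, G x i j * ψ x

/-- `G` is the distributional gradient of the scalar function `u` on `Ω`. -/
def HasWeakGradS (Ω : Set E3) (u : E3 → ℝ) (G : E3 → E3) : Prop :=
  ∀ ψ : E3 → ℝ, IsTestS Ω ψ → ∀ i,
    ∫ x in Ω, u x * pds ψ i x = - ∫ x in Ω, G x i * ψ x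

/-- Membership `v ∈ W^{1,p}_{0,σ}(Ω, d^α)` (with distributional gradient `G`):
`v` is measurable, `G` is its distributional gradient, the weighted norm is finite and
`v` is approximated by smooth compactly supported *solenoidal* fields in the weighted norm.
The unweighted space corresponds to `α = 0`. -/
structure MemW1pSigma (Ω : Set E3) (p α : ℝ) (v : E3 → E3)
    (G : E3 → Fin 3 → Fin 3 → ℝ) : Prop where
  meas : AEStronglyMeasurable v (volume.restrict Ω)
  weak_grad : HasWeakGrad Ω v G
  finite : IntegrableOn (fun x => dB Ω x ^ α * (‖v x‖ ^ p + frob (G x) ^ p)) Ω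
  approx : ∃ φ : ℕ → E3 → E3, (∀ n, IsTestSol Ω (φ n)) ∧
    Tendsto (fun n => ∫ x in Ω, dB Ω x ^ α *
        (‖v x - φ n x‖ ^ p + frob (fun i j => G x i j - gradv (φ n) x i j) ^ p))
      atTop (nhds 0)

/-- Membership `v ∈ W^{1,p}_0(Ω, d^α)` (with distributional gradient `G`):
as `MemW1pSigma` but approximating fields need not be divergence free. -/
structure MemW1p0 (Ω : Set E3) (p α : ℝ) (v : E3 → E3)
    (G : E3 → Fin 3 → Fin 3 → ℝ) : Prop where
  meas : AEStronglyMeasurable v (volume.restrict Ω)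
  weak_grad : HasWeakGrad Ω v G
  finite : IntegrableOn (fun x => dB Ω x ^ α * (‖v x‖ ^ p + frob (G x) ^ p)) Ω
  approx : ∃ φ : ℕ → E3 → E3, (∀ n, IsTest Ω (φ n)) ∧
    Tendsto (fun n => ∫ x in Ω, dB Ω x ^ α *
        (‖v x - φ n x‖ ^ p + frob (fun i j => G x i j - gradv (φ n) x i j) ^ p))
      atTop (nhds 0)

/-- A bounded open set of `ℝ³` with Lipschitz (`C^{0,1}`) boundary: near every boundary
point, after a rigid change of coordinates, the boundary is the graph of a Lipschitz
function `a` (with Lipschitz constant `r < 1`) and `Ω` lies locally above the graph. -/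
structure IsLipschitzDomain (Ω : Set E3) : Prop where
  nonempty : Ω.Nonempty
  isOpen : IsOpen Ω
  isBounded : IsBounded Ω
  charts : ∀ P ∈ frontier Ω, ∃ (f : E3 ≃ᵢ E3) (R R' r : ℝ) (a : E2 → ℝ),
    f P = 0 ∧ 0 < R ∧ 0 < R' ∧ 0 < r ∧ r < 1 ∧
    LipschitzWith (Real.toNNReal r) a ∧
    (∀ x' : E2, ‖x'‖ < R → |a x'| < R') ∧
    (∀ y : E3, ‖proj12 y‖ < R → |y 2| < R' →
      (f.symm y ∈ frontier Ω ↔ y 2 = a (proj12 y))) ∧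
    (∀ y : E3, ‖proj12 y‖ < R →
      a (proj12 y) < y 2 → y 2 < a (proj12 y) + R' → f.symm y ∈ Ω)

/-- A bounded open set of `ℝ³` with smooth (`C^∞`) boundary. -/
structure IsSmoothDomain (Ω : Set E3) : Prop where
  nonempty : Ω.Nonempty
  isOpen : IsOpen Ω
  isBounded : IsBounded Ω
  charts : ∀ P ∈ frontier Ω, ∃ (f : E3 ≃ᵢ E3) (R R' : ℝ) (a : E2 → ℝ),
    f P = 0 ∧ 0 < R ∧ 0 < R' ∧ ContDiff ℝ (⊤ : ℕ∞) a ∧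
    (∀ x' : E2, ‖x'‖ < R → |a x'| < R') ∧
    (∀ y : E3, ‖proj12 y‖ < R → |y 2| < R' →
      (f.symm y ∈ frontier Ω ↔ y 2 = a (proj12 y))) ∧
    (∀ y : E3, ‖proj12 y‖ < R →
      a (proj12 y) < y 2 → y 2 < a (proj12 y) + R' → f.symm y ∈ Ω)

/-- The axis-parallel closed cube with center `c` and half side-length `h`. -/
def cube (c : E3) (h : ℝ) : Set E3 := {x | ∀ i, |x i - c i| ≤ h}

/-- Average of (the nonnegative part of) `f` over a set, valued in `ℝ≥0∞`. -/
def lavg (s : Set E3) (f : E3 → ℝ) : ℝ≥0∞ :=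
  (∫⁻ x in s, ENNReal.ofReal (f x)) / volume s

/-- The Muckenhoupt `A_p` condition for a weight `w` on `ℝ³`:
`(⨍_Q w)(⨍_Q w^{-1/(p-1)})^{p-1} ≤ C` uniformly over all cubes `Q`. -/
def IsMuckenhouptAp (w : E3 → ℝ) (p : ℝ) : Prop :=
  ∃ C : ℝ, ∀ (c : E3) (h : ℝ), 0 < h →
    lavg (cube c h) w * (lavg (cube c h) (fun x => w x ^ (-1 / (p - 1)))) ^ (p - 1)
      ≤ ENNReal.ofReal C


/-- Isometries of `E3` preserve volume. -/
lemma isometry_mp (f : E3 ≃ᵢ E3) : MeasurePreserving (f : E3 → E3) volume volume := by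
  have h1 := f.toRealLinearIsometryEquiv.measurePreserving
  have h2 := measurePreserving_add_right (volume : Measure E3) (f 0)
  have h3 := h2.comp h1
  have h4 : (f : E3 → E3) = (fun x => x + f 0) ∘ ⇑f.toRealLinearIsometryEquiv := by
    funext x
    simp [IsometryEquiv.toRealLinearIsometryEquiv_apply]
  rw [h4]; exact h3

lemma volume_isometry_preimage (f : E3 ≃ᵢ E3) (s : Set E3) :
    volume ((f : E3 → E3) ⁻¹' s) = volume s := by
  have h := isometry_mp f
  have := MeasurePreserving.measure_preimage_equiv (f := f.toHomeomorph.toMeasurableEquiv)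
    (μa := volume) (μb := volume) (by simpa using h) s
  simpa using this

lemma continuous_proj12 : Continuous proj12 := by
  unfold proj12 mk2
  refine (PiLp.continuous_toLp 2 _).comp ?_
  refine continuous_pi fun i => ?_
  fin_cases i <;> simp <;> fun_prop

/-- The cylinder over a square between two vertical translates of a graph. -/
def slab (a : E2 → ℝ) (u v ρ s t : ℝ) : Set E3 :=
  {y | (|y 0 - u| ≤ ρ ∧ |y 1 - v| ≤ ρ) ∧ a (proj12 y) + s < y 2 ∧ y 2 ≤ a (proj12 y) + t}

lemma measurableSet_slab {a : E2 → ℝ} (ha : Continuous a) (u v ρ s t : ℝ) :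
    MeasurableSet (slab a u v ρ s t) := by
  have hc := ha.comp continuous_proj12
  have h0 : Continuous fun y : E3 => |y 0 - u| := by fun_prop
  have h1 : Continuous fun y : E3 => |y 1 - v| := by fun_prop
  have h2 : Continuous fun y : E3 => y 2 := by fun_prop
  unfold slab
  refine MeasurableSet.inter (MeasurableSet.inter ?_ ?_) (MeasurableSet.inter ?_ ?_)
  · exact (isClosed_le h0 continuous_const).measurableSet
  · exact (isClosed_le h1 continuous_const).measurableSet
  · exact (isOpen_lt (hc.add continuous_const) h2).measurableSet
  · exact (isClosed_le h2 (hc.add continuous_const)).measurableSet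

lemma volume_slab {a : E2 → ℝ} (ha : Continuous a) (u v ρ s t : ℝ) :
    volume (slab a u v ρ s t)
      = ENNReal.ofReal (t - s) * (ENNReal.ofReal (2 * ρ) * ENNReal.ofReal (2 * ρ)) := by
  let e := MeasurableEquiv.piFinSuccAbove (fun _ : Fin 3 => ℝ) 2
  have he := volume_preserving_piFinSuccAbove (fun _ : Fin 3 => ℝ) 2
  let A : Set (Fin 2 → ℝ) := Set.univ.pi fun i => Set.Icc (![u, v] i - ρ) (![u, v] i + ρ)
  let T : Set (ℝ × (Fin 2 → ℝ)) :=
    {q | q.2 ∈ A ∧ q.1 ∈ Set.Ioc (a (WithLp.toLp 2 q.2) + s) (a (WithLp.toLp 2 q.2) + t)}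
  have hST : slab a u v ρ s t = (MeasurableEquiv.toLp 2 (Fin 3 → ℝ)).symm ⁻¹' (e ⁻¹' T) := by
    ext y
    have hp : (fun j => y (Fin.succAbove 2 j) : Fin 2 → ℝ) = ![y 0, y 1] := by
      ext j; fin_cases j <;> simp <;> rfl
    have hp2 : WithLp.toLp 2 ![y 0, y 1] = proj12 y := rfl
    have : e ((MeasurableEquiv.toLp 2 (Fin 3 → ℝ)).symm y) = (y 2, ![y 0, y 1]) := by
      rw [← hp]; rfl
    simp only [Set.mem_preimage, this]
    simp only [slab, T, A, Set.mem_ofPred_eq, hp2, Set.mem_pi, Fin.forall_fin_two, Set.mem_Icc,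
      Set.mem_Ioc, abs_le, Set.mem_univ, true_imp_iff]
    simp only [Matrix.cons_val_zero, Matrix.cons_val_one]
    constructor
    · rintro ⟨⟨⟨h1, h2⟩, h3, h4⟩, h5⟩
      exact ⟨⟨⟨by linarith, by linarith⟩, by linarith, by linarith⟩, h5⟩
    · rintro ⟨⟨⟨h1, h2⟩, h3, h4⟩, h5⟩
      exact ⟨⟨⟨by linarith, by linarith⟩, by linarith, by linarith⟩, h5⟩
  have hA : MeasurableSet A := MeasurableSet.univ_pi fun i => measurableSet_Icc
  have hT : MeasurableSet T := by
    have hc : Continuous fun q : ℝ × (Fin 2 → ℝ) => a (WithLp.toLp 2 q.2) :=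
      ha.comp ((PiLp.continuous_toLp 2 _).comp continuous_snd)
    refine MeasurableSet.inter (measurable_snd hA) (MeasurableSet.inter ?_ ?_)
    · exact (isOpen_lt (hc.add continuous_const) continuous_fst).measurableSet
    · exact (isClosed_le continuous_fst (hc.add continuous_const)).measurableSet
  rw [hST, (EuclideanSpace.volume_preserving_symm_measurableEquiv_toLp
    (Fin 3)).measure_preimage_equiv, he.measure_preimage_equiv]
  have : (volume : Measure (ℝ × (Fin 2 → ℝ))) = (volume : Measure ℝ).prod volume := rfl
  rw [show (volume T : ℝ≥0∞) = ((volume : Measure ℝ).prod (volume : Measure (Fin 2 → ℝ))) T from rfl,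
    Measure.prod_apply_symm hT]
  have hsec : ∀ q : Fin 2 → ℝ, volume ((fun x : ℝ => (x, q)) ⁻¹' T)
      = A.indicator (fun _ => ENNReal.ofReal (t - s)) q := by
    intro q
    by_cases hq : q ∈ A
    · have : (fun x : ℝ => (x, q)) ⁻¹' T
          = Set.Ioc (a (WithLp.toLp 2 q) + s) (a (WithLp.toLp 2 q) + t) := by
        ext x; simp [T, hq]
      rw [this, Real.volume_Ioc]; simp [hq]
    · have : (fun x : ℝ => (x, q)) ⁻¹' T = ∅ := by
        ext x; simp [T, hq]
      rw [this]; simp [hq]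
  simp_rw [hsec]
  rw [lintegral_indicator_const hA]
  congr 1
  rw [volume_pi_pi, Fin.prod_univ_two]
  simp only [Real.volume_Icc, Matrix.cons_val_zero, Matrix.cons_val_one]
  congr 2 <;> ring

lemma volume_cube (c : E3) {h : ℝ} (hh : 0 < h) :
    volume (cube c h) = ENNReal.ofReal ((2 * h) ^ 3) := by
  have : cube c h = (MeasurableEquiv.toLp 2 (Fin 3 → ℝ)).symm ⁻¹'
      (Set.Icc (fun i => c i - h) (fun i => c i + h)) := by
    ext y
    simp only [cube, Set.mem_ofPred_eq, Set.mem_preimage, Set.mem_Icc, Pi.le_def, abs_le]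
    constructor
    · intro H
      exact ⟨fun i => by have := H i; change _ ≤ y i; linarith, fun i => by have := H i; change y i ≤ _; linarith⟩
    · rintro ⟨H1, H2⟩ i
      have h1 : c i - h ≤ y i := H1 i
      have h2 : y i ≤ c i + h := H2 i
      constructor <;> linarith
  rw [this, (EuclideanSpace.volume_preserving_symm_measurableEquiv_toLp
    (Fin 3)).measure_preimage_equiv, Real.volume_Icc_pi, Fin.prod_univ_three]
  have : c.ofLp 0 + h - (c.ofLp 0 - h) = 2 * h := by ring
  have : ∀ i, c.ofLp i + h - (c.ofLp i - h) = 2 * h := fun i => by ring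
  simp only [this]
  rw [← ENNReal.ofReal_mul (by positivity), ← ENNReal.ofReal_mul (by positivity)]
  congr 1; ring

lemma coord_le_norm (x : E3) (i : Fin 3) : |x i| ≤ ‖x‖ := by
  simpa using PiLp.norm_apply_le x i

lemma proj12_norm_le (x : E3) : ‖proj12 x‖ ≤ ‖x‖ := by
  rw [EuclideanSpace.norm_eq, EuclideanSpace.norm_eq]
  apply Real.sqrt_le_sqrt
  rw [Fin.sum_univ_two, Fin.sum_univ_three]
  have h0 : proj12 x 0 = x 0 := rfl
  have h1 : proj12 x 1 = x 1 := rfl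
  rw [h0, h1]
  nlinarith [sq_nonneg ‖x 2‖]

lemma proj12_sub (x y : E3) : proj12 (x - y) = proj12 x - proj12 y := by
  ext i; fin_cases i <;> rfl

lemma cube_dist_le {c x : E3} {h : ℝ} (hh : 0 < h) (hx : x ∈ cube c h) : dist x c ≤ 2 * h := by
  rw [dist_eq_norm, EuclideanSpace.norm_eq]
  apply Real.sqrt_le_iff.mpr
  refine ⟨by positivity, ?_⟩
  have H : ∀ i, ‖(x - c) i‖ ^ 2 ≤ h ^ 2 := by
    intro i
    have := hx i
    rw [Real.norm_eq_abs]
    exact pow_le_pow_left₀ (abs_nonneg _) this 2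
  rw [Fin.sum_univ_three]
  nlinarith [H 0, H 1, H 2, sq_nonneg h]

lemma measurableSet_cube (c : E3) (h : ℝ) : MeasurableSet (cube c h) := by
  have : cube c h = ⋂ i, {x : E3 | |x i - c i| ≤ h} := by ext; simp [cube]
  rw [this]
  refine MeasurableSet.iInter fun i => ?_
  have h0 : Continuous fun y : E3 => |y i - c i| := by fun_prop
  exact (isClosed_le h0 continuous_const).measurableSet

lemma dB_nonneg (Ω : Set E3) (x : E3) : 0 ≤ dB Ω x := Metric.infDist_nonneg

lemma continuous_dB (Ω : Set E3) : Continuous (dB Ω) := Metric.continuous_infDist_pt _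

lemma frontier_compact {Ω : Set E3} (hΩ : IsLipschitzDomain Ω) : IsCompact (frontier Ω) :=
  (Metric.isCompact_of_isClosed_isBounded isClosed_frontier
    (hΩ.isBounded.closure.subset frontier_subset_closure))

lemma frontier_nonempty {Ω : Set E3} (hΩ : IsLipschitzDomain Ω) : (frontier Ω).Nonempty := by
  rw [nonempty_frontier_iff]
  refine ⟨hΩ.nonempty, ?_⟩
  rintro rfl
  exact NormedSpace.unbounded_univ ℝ E3 hΩ.isBounded

lemma exists_nearest {Ω : Set E3} (hΩ : IsLipschitzDomain Ω) (x : E3) :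
    ∃ z ∈ frontier Ω, dB Ω x = dist x z :=
  (frontier_compact hΩ).exists_infDist_eq_dist (frontier_nonempty hΩ) x

lemma dB_pos {Ω : Set E3} (hΩ : IsLipschitzDomain Ω) {x : E3} (hx : x ∈ Ω) : 0 < dB Ω x := by
  refine (isClosed_frontier.notMem_iff_infDist_pos (frontier_nonempty hΩ)).1 ?_
  intro h
  have := hΩ.isOpen.inter_frontier_eq
  exact (this ▸ (⟨hx, h⟩ : x ∈ Ω ∩ frontier Ω) : x ∈ (∅ : Set E3))

lemma dB_lip (Ω : Set E3) (x y : E3) : dB Ω x ≤ dB Ω y + dist x y :=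
  Metric.infDist_le_infDist_add_dist

lemma tube_local {Ω : Set E3} (hΩ : IsLipschitzDomain Ω) (P : E3) (hP : P ∈ frontier Ω) :
    ∃ δ > 0, ∀ z, dist z P < δ → ∀ ρ t : ℝ, 0 < t → t ≤ ρ → ρ ≤ δ →
      volume (Metric.ball z ρ ∩ {x | dB Ω x < t}) ≤ ENNReal.ofReal (20 * t * ρ ^ 2) := by
  obtain ⟨f, R, R', r, a, hf, hR, hR', hr, hr1, ha, haR, hgr, -⟩ := hΩ.charts P hP
  refine ⟨min R R' / 4, by positivity, ?_⟩
  intro z hz ρ t ht htρ hρ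
  have hm1 := min_le_left R R'
  have hm2 := min_le_right R R'
  set m := min R R'
  have hsub : Metric.ball z ρ ∩ {x | dB Ω x < t}
      ⊆ (f : E3 → E3) ⁻¹' slab a (f z 0) (f z 1) ρ (-(3 * t)) (2 * t) := by
    rintro x ⟨hx, hxt⟩
    rw [Metric.mem_ball] at hx
    have hxt : dB Ω x < t := hxt
    obtain ⟨w, hw, hdw⟩ := exists_nearest hΩ x
    rw [hdw] at hxt
    have hxz : ‖f x - f z‖ < ρ := by rwa [← dist_eq_norm, f.dist_eq]
    have hxw : ‖f x - f w‖ < t := by rwa [← dist_eq_norm, f.dist_eq]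
    have hw0 : ‖f w‖ < m := by
      have h1 : ‖f w‖ = dist w P := by rw [← f.dist_eq w P, hf, dist_zero_right]
      have h2 := dist_triangle4 w x z P
      rw [dist_comm w x] at h2
      linarith
    have hwa : f w 2 = a (proj12 (f w)) := by
      refine (hgr (f w) ?_ ?_).1 (by simpa using hw)
      · exact lt_of_le_of_lt (proj12_norm_le _) (by linarith)
      · exact lt_of_le_of_lt (coord_le_norm _ _) (by linarith)
    have hal : |a (proj12 (f x)) - a (proj12 (f w))| ≤ t := by
      have h1 := ha.dist_le_mul (proj12 (f x)) (proj12 (f w))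
      rw [Real.dist_eq, dist_eq_norm, ← proj12_sub, Real.coe_toNNReal _ hr.le] at h1
      have h2 := proj12_norm_le (f x - f w)
      have h3 := norm_nonneg (proj12 (f x - f w))
      nlinarith
    have h2 : |f x 2 - f w 2| < t := lt_of_le_of_lt (coord_le_norm (f x - f w) 2) hxw
    have h0 : |f x 0 - f z 0| < ρ := lt_of_le_of_lt (coord_le_norm (f x - f z) 0) hxz
    have h1 : |f x 1 - f z 1| < ρ := lt_of_le_of_lt (coord_le_norm (f x - f z) 1) hxz
    rw [abs_le] at hal
    rw [abs_lt] at h2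
    exact ⟨⟨h0.le, h1.le⟩, by linarith, by linarith⟩
  refine (measure_mono hsub).trans ?_
  rw [volume_isometry_preimage, volume_slab ha.continuous, ← ENNReal.ofReal_mul (by linarith),
    ← ENNReal.ofReal_mul (by linarith)]
  apply ENNReal.ofReal_le_ofReal
  apply le_of_eq; ring

lemma tube_small {Ω : Set E3} (hΩ : IsLipschitzDomain Ω) :
    ∃ δ > 0, ∀ z ∈ frontier Ω, ∀ ρ t : ℝ, 0 < t → t ≤ ρ → ρ ≤ δ →
      volume (Metric.ball z ρ ∩ {x | dB Ω x < t}) ≤ ENNReal.ofReal (20 * t * ρ ^ 2) := by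
  refine (frontier_compact hΩ).induction_on (p := fun s => ∃ δ > 0, ∀ z ∈ s,
      ∀ ρ t : ℝ, 0 < t → t ≤ ρ → ρ ≤ δ →
      volume (Metric.ball z ρ ∩ {x | dB Ω x < t}) ≤ ENNReal.ofReal (20 * t * ρ ^ 2))
    ⟨1, one_pos, by simp⟩ ?_ ?_ ?_
  · rintro s t hst ⟨δ, hδ, h⟩
    exact ⟨δ, hδ, fun z hz => h z (hst hz)⟩
  · rintro s t ⟨δ, hδ, h⟩ ⟨δ', hδ', h'⟩
    refine ⟨min δ δ', lt_min hδ hδ', ?_⟩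
    rintro z (hz | hz) ρ u h0 h1 h2
    · exact h z hz ρ u h0 h1 (h2.trans (min_le_left _ _))
    · exact h' z hz ρ u h0 h1 (h2.trans (min_le_right _ _))
  · intro P hP
    obtain ⟨δ, hδ, h⟩ := tube_local hΩ P hP
    exact ⟨Metric.ball P δ, mem_nhdsWithin_of_mem_nhds (Metric.ball_mem_nhds P hδ), δ, hδ,
      fun z hz => h z hz⟩

lemma tube {Ω : Set E3} (hΩ : IsLipschitzDomain Ω) :
    ∃ C > 0, ∀ z ∈ frontier Ω, ∀ ρ t : ℝ, 0 < t → t ≤ ρ →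
      volume (Metric.ball z ρ ∩ {x | dB Ω x < t}) ≤ ENNReal.ofReal (C * t * ρ ^ 2) := by
  obtain ⟨δ, hδ, h⟩ := tube_small hΩ
  have hK := frontier_compact hΩ
  obtain ⟨F, hFK, hF⟩ := hK.elim_nhds_subcover (fun x => Metric.ball x (δ / 2))
    (fun x _ => Metric.ball_mem_nhds x (by positivity))
  obtain ⟨D, hD0, hD⟩ : ∃ D > 0, ∀ z ∈ frontier Ω, ∀ w ∈ frontier Ω, dist w z ≤ D := by
    obtain ⟨D, hD⟩ := Metric.isBounded_iff.1 hK.isBounded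
    exact ⟨max D 1, by positivity, fun z hz w hw => (hD hw hz).trans (le_max_left _ _)⟩
  set V : ℝ := (volume (Metric.ball (0 : E3) 1)).toReal with hV
  have hV' : volume (Metric.ball (0 : E3) 1) = ENNReal.ofReal V := by
    rw [hV, ENNReal.ofReal_toReal measure_ball_lt_top.ne]
  have hV0 : 0 ≤ V := ENNReal.toReal_nonneg
  obtain ⟨N, hN⟩ : ∃ N : ℕ, N = F.card := ⟨_, rfl⟩
  have hN0 : (0 : ℝ) ≤ N := Nat.cast_nonneg N
  refine ⟨20 + N * 20 + (2 * D / δ + 1) ^ 3 * V, by positivity, ?_⟩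
  intro z hz ρ t ht htρ
  have hρ : 0 < ρ := by linarith
  have hA : 0 ≤ t * ρ ^ 2 := by positivity
  have hB : 0 ≤ (2 * D / δ + 1) ^ 3 * V := by positivity
  have hB' : (0 : ℝ) ≤ N * 20 := by positivity
  rcases le_total ρ δ with h1 | h1
  · refine (h z hz ρ t ht htρ h1).trans (ENNReal.ofReal_le_ofReal ?_)
    nlinarith
  rcases le_total t (δ / 2) with h2 | h2
  · have hsub : Metric.ball z ρ ∩ {x | dB Ω x < t}
        ⊆ ⋃ w ∈ F, (Metric.ball w δ ∩ {x | dB Ω x < t}) := by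
      rintro x ⟨-, hx⟩
      have hx' : dB Ω x < t := hx
      obtain ⟨y, hy, hxy⟩ := exists_nearest hΩ x
      have := hF hy
      simp only [Set.mem_iUnion, Metric.mem_ball, exists_prop] at this ⊢
      obtain ⟨w, hw, hyw⟩ := this
      refine ⟨w, hw, ?_, hx⟩
      rw [Metric.mem_ball]
      have := dist_triangle x y w
      linarith
    refine (measure_mono hsub).trans ((measure_biUnion_finset_le _ _).trans ?_)
    refine (Finset.sum_le_sum fun w hw => h w (hFK w hw) δ t ht (by linarith) le_rfl).trans ?_
    rw [Finset.sum_const, nsmul_eq_mul, ← hN, ← ENNReal.ofReal_natCast, ← ENNReal.ofReal_mul hN0]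
    apply ENNReal.ofReal_le_ofReal
    have : t * δ ^ 2 ≤ t * ρ ^ 2 := by gcongr
    nlinarith
  · have hsub : Metric.ball z ρ ∩ {x | dB Ω x < t} ⊆ Metric.ball z (D + t) := by
      rintro x ⟨-, hx⟩
      have hx' : dB Ω x < t := hx
      obtain ⟨y, hy, hxy⟩ := exists_nearest hΩ x
      rw [Metric.mem_ball]
      have := dist_triangle x y z
      have := hD z hz y hy
      linarith
    refine (measure_mono hsub).trans ?_
    rw [Measure.addHaar_ball_of_pos _ _ (by positivity), hV', ← ENNReal.ofReal_mul (by positivity)]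
    apply ENNReal.ofReal_le_ofReal
    have e1 : Module.finrank ℝ E3 = 3 := by simp
    rw [e1]
    have e2 : D + t ≤ (2 * D / δ + 1) * t := by
      have : D ≤ 2 * D / δ * t := by
        rw [div_mul_eq_mul_div, le_div_iff₀ hδ]; nlinarith
      linarith
    have e3 : (D + t) ^ 3 ≤ (2 * D / δ + 1) ^ 3 * (t * ρ ^ 2) := by
      calc (D + t) ^ 3 ≤ ((2 * D / δ + 1) * t) ^ 3 := by gcongr
        _ = (2 * D / δ + 1) ^ 3 * (t * t ^ 2) := by ring
        _ ≤ _ := by gcongr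
    have e4 : (D + t) ^ 3 * V ≤ (2 * D / δ + 1) ^ 3 * (t * ρ ^ 2) * V := by gcongr
    nlinarith

lemma lint_neg {Ω : Set E3} (hΩ : IsLipschitzDomain Ω) {β : ℝ} (hβ : -1 < β) (hβ0 : β < 0) :
    ∃ C > 0, ∀ z ∈ frontier Ω, ∀ ρ : ℝ, 0 < ρ →
      ∫⁻ x in Metric.ball z ρ, ENNReal.ofReal (dB Ω x ^ β)
        ≤ ENNReal.ofReal (C * ρ ^ β * ρ ^ 3) := by
  obtain ⟨C, hC, htube⟩ := tube hΩ
  set q : ℝ := 2 ^ (-(1 + β)) with hq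
  have hq0 : 0 < q := by positivity
  have hq1 : q < 1 := Real.rpow_lt_one_of_one_lt_of_neg (by norm_num) (by linarith)
  refine ⟨C * 8 * 2 ^ (-β) * (1 - q)⁻¹, ?_, ?_⟩
  · have : 0 < 1 - q := by linarith
    positivity
  intro z hz ρ hρ
  let S : ℕ → Set E3 := fun k => Metric.ball z ρ ∩ {x | ρ / 2 ^ (k + 1) < dB Ω x ∧ dB Ω x ≤ ρ / 2 ^ k}
  let Z : Set E3 := {x | dB Ω x = 0}
  have hsub : Metric.ball z ρ ⊆ Z ∪ ⋃ k, S k := by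
    intro x hx
    have hxρ : dB Ω x < ρ := lt_of_le_of_lt (Metric.infDist_le_dist_of_mem hz) hx
    rcases (dB_nonneg Ω x).eq_or_lt with h0 | h0
    · exact Or.inl h0.symm
    · right
      obtain ⟨n, hn1, hn2⟩ := exists_nat_pow_near (x := ρ / dB Ω x) (y := 2)
        (by rw [le_div_iff₀ h0]; linarith) (by norm_num)
      rw [le_div_iff₀ h0] at hn1
      rw [div_lt_iff₀ h0] at hn2
      refine Set.mem_iUnion.2 ⟨n, hx, ?_, ?_⟩
      · rw [div_lt_iff₀ (by positivity)]; linarith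
      · rw [le_div_iff₀ (by positivity)]; linarith
  have hZ : ∫⁻ x in Z, ENNReal.ofReal (dB Ω x ^ β) = 0 := by
    have hZm : MeasurableSet Z :=
      ((isClosed_singleton (x := (0 : ℝ))).preimage (continuous_dB Ω)).measurableSet
    rw [setLIntegral_eq_zero_iff hZm]
    · refine Eventually.of_forall fun x hx => ?_
      have hx : dB Ω x = 0 := hx
      rw [hx, Real.zero_rpow hβ0.ne, ENNReal.ofReal_zero]
    · exact ((continuous_dB Ω).measurable.pow_const β).ennreal_ofReal
  have hS : ∀ k, ∫⁻ x in S k, ENNReal.ofReal (dB Ω x ^ β)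
      ≤ ENNReal.ofReal (C * 8 * 2 ^ (-β) * ρ ^ β * ρ ^ 3 * q ^ k) := by
    intro k
    have hcl : 0 < ρ / 2 ^ (k + 1) := by positivity
    calc ∫⁻ x in S k, ENNReal.ofReal (dB Ω x ^ β)
        ≤ ∫⁻ x in S k, ENNReal.ofReal ((ρ / 2 ^ (k + 1)) ^ β) := by
          refine setLIntegral_mono measurable_const fun x hx => ENNReal.ofReal_le_ofReal ?_
          exact Real.rpow_le_rpow_of_nonpos hcl hx.2.1.le hβ0.le
      _ = ENNReal.ofReal ((ρ / 2 ^ (k + 1)) ^ β) * volume (S k) := by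
          rw [setLIntegral_const]
      _ ≤ ENNReal.ofReal ((ρ / 2 ^ (k + 1)) ^ β) *
            ENNReal.ofReal (C * (2 * (ρ / 2 ^ k)) * (2 * ρ) ^ 2) := by
          gcongr
          refine le_trans (measure_mono ?_) (htube z hz (2 * ρ) (2 * (ρ / 2 ^ k)) (by positivity) ?_)
          · rintro x ⟨hx1, hx2⟩
            refine ⟨Metric.ball_subset_ball (by linarith) hx1, ?_⟩
            have : 0 < ρ / 2 ^ k := by positivity
            have := hx2.2
            change dB Ω x < _
            linarith
          · have : ρ / 2 ^ k ≤ ρ := div_le_self hρ.le (one_le_pow₀ (by norm_num))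
            linarith
      _ = _ := by
          rw [← ENNReal.ofReal_mul (by positivity)]
          congr 1
          have e1 : (ρ / 2 ^ (k + 1)) ^ β = ρ ^ β * 2 ^ (-β) * (2 ^ (-β)) ^ k := by
            rw [Real.div_rpow hρ.le (by positivity), ← Real.rpow_natCast 2 (k + 1),
              ← Real.rpow_mul (by norm_num), ← Real.rpow_natCast (2 ^ (-β)) k,
              ← Real.rpow_mul (by norm_num), mul_assoc, ← Real.rpow_add (by norm_num),
              div_eq_mul_inv, ← Real.rpow_neg (by norm_num)]
            congr 2; push_cast; ring
          have e2 : q ^ k = (2 ^ (-β)) ^ k * (2 ^ k)⁻¹ := by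
            rw [← inv_pow, ← mul_pow, hq]
            congr 1
            rw [show -(1 + β) = -β + (-1) by ring, Real.rpow_add (by norm_num), Real.rpow_neg_one]
          rw [e1, e2]
          field_simp
          ring
  calc ∫⁻ x in Metric.ball z ρ, ENNReal.ofReal (dB Ω x ^ β)
      ≤ ∫⁻ x in Z ∪ ⋃ k, S k, ENNReal.ofReal (dB Ω x ^ β) := lintegral_mono_set hsub
    _ ≤ (∫⁻ x in Z, ENNReal.ofReal (dB Ω x ^ β)) + ∫⁻ x in ⋃ k, S k, ENNReal.ofReal (dB Ω x ^ β) :=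
        lintegral_union_le _ _ _
    _ ≤ 0 + ∑' k, ∫⁻ x in S k, ENNReal.ofReal (dB Ω x ^ β) := by
        rw [hZ]; gcongr; exact lintegral_iUnion_le _ _
    _ ≤ ∑' k, ENNReal.ofReal (C * 8 * 2 ^ (-β) * ρ ^ β * ρ ^ 3 * q ^ k) := by
        rw [zero_add]; exact ENNReal.tsum_le_tsum hS
    _ = _ := by
        rw [← ENNReal.ofReal_tsum_of_nonneg (fun k => by positivity)
          ((summable_geometric_of_lt_one hq0.le hq1).mul_left _), _root_.tsum_mul_left,
          tsum_geometric_of_lt_one hq0.le hq1]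
        congr 1; ring

lemma rpow_comp {x D β M : ℝ} (hM : 1 ≤ M) (hx : 0 < x) (hD : 0 < D) (h1 : x ≤ M * D)
    (h2 : D ≤ M * x) : x ^ β ≤ M ^ |β| * D ^ β := by
  rcases le_total 0 β with hb | hb
  · rw [abs_of_nonneg hb, ← Real.mul_rpow (by linarith) hD.le]
    exact Real.rpow_le_rpow hx.le h1 hb
  · rw [abs_of_nonpos hb, Real.rpow_neg (by linarith), ← Real.inv_rpow (by linarith),
      ← Real.mul_rpow (by positivity) hD.le]
    refine Real.rpow_le_rpow_of_nonpos (by positivity) ?_ hb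
    rw [inv_mul_le_iff₀ (by positivity)]; exact h2

lemma lavg_le {Ω : Set E3} (hΩ : IsLipschitzDomain Ω) {β : ℝ} (hβ : -1 < β) :
    ∃ C > 0, ∀ (c : E3) (h : ℝ), 0 < h →
      lavg (cube c h) (fun x => dB Ω x ^ β) ≤ ENNReal.ofReal (C * (max (dB Ω c) h) ^ β) := by
  -- bound from a pointwise bound
  have key : ∀ (c : E3) (h B : ℝ), 0 < h → (∀ x ∈ cube c h, dB Ω x ^ β ≤ B) →
      ∫⁻ x in cube c h, ENNReal.ofReal (dB Ω x ^ β) ≤ ENNReal.ofReal B * volume (cube c h) := by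
    intro c h B hh H
    rw [← setLIntegral_const]
    exact setLIntegral_mono measurable_const fun x hx => ENNReal.ofReal_le_ofReal (H x hx)
  -- near bound
  obtain ⟨C, hC, hnear⟩ : ∃ C > 0, ∀ z ∈ frontier Ω, ∀ (c : E3) (h : ℝ), 0 < h →
      cube c h ⊆ Metric.ball z (7 * h) →
      ∫⁻ x in cube c h, ENNReal.ofReal (dB Ω x ^ β)
        ≤ ENNReal.ofReal (C * (7 * h) ^ β) * volume (cube c h) := by
    rcases le_or_gt 0 β with hb | hb
    · refine ⟨1, one_pos, fun z hz c h hh hsub => key c h _ hh fun x hx => ?_⟩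
      rw [one_mul]
      refine Real.rpow_le_rpow (dB_nonneg _ _) ?_ hb
      exact (Metric.infDist_le_dist_of_mem hz).trans (le_of_lt (hsub hx))
    · obtain ⟨C, hC, H⟩ := lint_neg hΩ hβ hb
      refine ⟨C * (343 / 8), by positivity, fun z hz c h hh hsub => ?_⟩
      refine (lintegral_mono_set hsub).trans ((H z hz (7 * h) (by positivity)).trans ?_)
      rw [volume_cube c hh, ← ENNReal.ofReal_mul (by positivity)]
      apply ENNReal.ofReal_le_ofReal
      apply le_of_eq; ring
  refine ⟨2 ^ |β| + C * 7 ^ |β|, by positivity, fun c h hh => ?_⟩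
  unfold lavg
  refine ENNReal.div_le_of_le_mul ?_
  have hD : 0 < max (dB Ω c) h := lt_max_of_lt_right hh
  have hDβ : 0 < (max (dB Ω c) h) ^ β := by positivity
  have h7 : 0 < C * (7 : ℝ) ^ |β| := by positivity
  have h2 : 0 < (2 : ℝ) ^ |β| := by positivity
  rcases le_or_gt (4 * h) (dB Ω c) with hfar | hfar
  · refine key c h _ hh fun x hx => ?_
    have hmax : max (dB Ω c) h = dB Ω c := max_eq_left (by linarith)
    rw [hmax] at hD hDβ ⊢
    have hd := cube_dist_le hh hx
    have l1 := dB_lip Ω x c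
    have l2 := dB_lip Ω c x
    rw [dist_comm c x] at l2
    have := rpow_comp (x := dB Ω x) (D := dB Ω c) (β := β) (M := 2) (by norm_num) (by linarith) hD
      (by linarith) (by linarith)
    nlinarith
  · obtain ⟨z, hz, hcz⟩ := exists_nearest hΩ c
    have hsub : cube c h ⊆ Metric.ball z (7 * h) := by
      intro x hx
      have hd := cube_dist_le hh hx
      have := dist_triangle x c z
      rw [Metric.mem_ball]; linarith
    refine (hnear z hz c h hh hsub).trans ?_
    refine mul_le_mul_left (ENNReal.ofReal_le_ofReal ?_) _
    have hm : max (dB Ω c) h ≤ 4 * h := max_le (by linarith) (by linarith)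
    have hm' : h ≤ max (dB Ω c) h := le_max_right _ _
    have := rpow_comp (x := 7 * h) (D := max (dB Ω c) h) (β := β) (M := 7) (by norm_num)
      (by linarith) hD (by linarith) (by linarith)
    have := mul_le_mul_of_nonneg_left this hC.le
    nlinarith

lemma muck_of_range {Ω : Set E3} (hΩ : IsLipschitzDomain Ω) {p α : ℝ} (hp : 1 < p)
    (h1 : -1 < α) (h2 : α < p - 1) : IsMuckenhouptAp (fun x => dB Ω x ^ α) p := by
  have hp1 : 0 < p - 1 := by linarith
  obtain ⟨C1, hC1, H1⟩ := lavg_le hΩ h1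
  have hβ : -1 < α * (-1 / (p - 1)) := by
    rw [mul_div_assoc', lt_div_iff₀ hp1]; linarith
  obtain ⟨C2, hC2, H2⟩ := lavg_le hΩ hβ
  refine ⟨C1 * C2 ^ (p - 1), fun c h hh => ?_⟩
  have e : (fun x => (dB Ω x ^ α) ^ (-1 / (p - 1))) = fun x => dB Ω x ^ (α * (-1 / (p - 1))) := by
    funext x; rw [Real.rpow_mul (dB_nonneg Ω x)]
  rw [e]
  have hD : 0 < max (dB Ω c) h := lt_max_of_lt_right hh
  set D := max (dB Ω c) h
  calc _ ≤ ENNReal.ofReal (C1 * D ^ α) *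
        (ENNReal.ofReal (C2 * D ^ (α * (-1 / (p - 1))))) ^ (p - 1) := by
        gcongr
        · exact H1 c h hh
        · exact H2 c h hh
    _ = _ := by
        rw [ENNReal.ofReal_rpow_of_nonneg (by positivity) hp1.le,
          ← ENNReal.ofReal_mul (by positivity)]
        congr 1
        rw [Real.mul_rpow hC2.le (by positivity), ← Real.rpow_mul hD.le,
          show α * (-1 / (p - 1)) * (p - 1) = -α by field_simp, Real.rpow_neg hD.le]
        field_simp

lemma lint_pos {Ω : Set E3} (hΩ : IsLipschitzDomain Ω) (β : ℝ) {P : E3} (hP : P ∈ frontier Ω)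
    {h : ℝ} (hh : 0 < h) : 0 < ∫⁻ x in cube P h, ENNReal.ofReal (dB Ω x ^ β) := by
  rw [lintegral_pos_iff_support
    (((continuous_dB Ω).measurable.pow_const β).ennreal_ofReal)]
  have hsub : Metric.ball P h ∩ Ω ⊆ Function.support fun x => ENNReal.ofReal (dB Ω x ^ β) := by
    rintro x ⟨-, hx⟩
    have := dB_pos hΩ hx
    have : 0 < dB Ω x ^ β := by positivity
    simpa [Function.mem_support] using this
  have hcube : Metric.ball P h ⊆ cube P h := by
    intro x hx i
    rw [Metric.mem_ball, dist_eq_norm] at hx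
    exact (coord_le_norm (x - P) i).trans hx.le
  have hne : (Metric.ball P h ∩ Ω).Nonempty :=
    mem_closure_iff_nhds.1 (frontier_subset_closure hP) _ (Metric.ball_mem_nhds P hh)
  have hopen : IsOpen (Metric.ball P h ∩ Ω) := Metric.isOpen_ball.inter hΩ.isOpen
  refine lt_of_lt_of_le (hopen.measure_pos volume hne) ?_
  rw [Measure.restrict_apply' (measurableSet_cube P h)]
  exact measure_mono fun x hx => ⟨hsub hx, hcube hx.1⟩

lemma lint_top {Ω : Set E3} (hΩ : IsLipschitzDomain Ω) {β : ℝ} (hβ : β ≤ -1) {P : E3}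
    (hP : P ∈ frontier Ω) :
    ∃ h > 0, ∫⁻ x in cube P h, ENNReal.ofReal (dB Ω x ^ β) = ∞ := by
  obtain ⟨f, R, R', r, a, hf, hR, hR', hr, hr1, ha, haR, hgr, hin⟩ := hΩ.charts P hP
  refine ⟨R + 2 * R', by positivity, ?_⟩
  let s : ℕ → ℝ := fun k => R' / 2 / 2 ^ k
  have hs0 : ∀ k, 0 < s k := fun k => by positivity
  have hsle : ∀ k, s k ≤ R' / 2 := fun k =>
    div_le_self (by positivity) (one_le_pow₀ (by norm_num))
  have hss : ∀ k, s (k + 1) = s k / 2 := fun k => by simp only [s, pow_succ]; field_simp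
  have hanti : Antitone s := antitone_nat_of_succ_le fun k => by
    rw [hss]; linarith [hs0 k]
  let S : ℕ → Set E3 := fun k => (f : E3 → E3) ⁻¹' slab a 0 0 (R / 2) (s (k + 1)) (s k)
  have hSm : ∀ k, MeasurableSet (S k) := fun k =>
    f.continuous.measurable (measurableSet_slab ha.continuous _ _ _ _ _)
  have hSv : ∀ k, volume (S k) = ENNReal.ofReal (s k / 2 * (R * R)) := by
    intro k
    rw [volume_isometry_preimage, volume_slab ha.continuous, hss,
      ← ENNReal.ofReal_mul (by positivity), ← ENNReal.ofReal_mul (by linarith [hs0 k])]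
    congr 1; ring
  have hdis : Pairwise (Function.onFun Disjoint S) := by
    have main : ∀ i j, i < j → Disjoint (S i) (S j) := by
      intro i j hij
      rw [Set.disjoint_left]
      rintro x ⟨-, h1, -⟩ ⟨-, -, h2⟩
      have := hanti (Nat.succ_le_of_lt hij)
      simp only [Nat.succ_eq_add_one] at this
      linarith
    intro i j hij
    rcases lt_or_gt_of_ne hij with h | h
    · exact main i j h
    · exact (main j i h).symm
  have hproj : ∀ y : E3, |y 0 - 0| ≤ R / 2 → |y 1 - 0| ≤ R / 2 → ‖proj12 y‖ < R := by
    intro y h0 h1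
    rw [EuclideanSpace.norm_eq, Fin.sum_univ_two, Real.sqrt_lt' hR]
    have e0 : proj12 y 0 = y 0 := rfl
    have e1 : proj12 y 1 = y 1 := rfl
    rw [e0, e1, Real.norm_eq_abs, Real.norm_eq_abs]
    rw [sub_zero] at h0 h1
    nlinarith [abs_nonneg (y 0), abs_nonneg (y 1)]
  have hpt : ∀ k, ∀ x ∈ S k, x ∈ cube P (R + 2 * R') ∧ 0 < dB Ω x ∧ dB Ω x ≤ s k := by
    rintro k x ⟨⟨h0, h1⟩, h2, h3⟩
    have hp := hproj (f x) h0 h1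
    have ha' := haR _ hp
    have hsk := hsle k
    have hsk1 := hs0 (k + 1)
    refine ⟨?_, ?_, ?_⟩
    · intro i
      refine (coord_le_norm (x - P) i).trans ?_
      rw [← dist_eq_norm, ← f.dist_eq, hf, dist_zero_right, EuclideanSpace.norm_eq,
        Fin.sum_univ_three]
      apply Real.sqrt_le_iff.mpr
      refine ⟨by positivity, ?_⟩
      rw [sub_zero] at h0 h1
      have h4 : |f x 2| ≤ 2 * R' := by
        rw [abs_lt] at ha'; rw [abs_le]; constructor <;> linarith
      simp only [Real.norm_eq_abs]
      have k0 := pow_le_pow_left₀ (abs_nonneg _) h0 2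
      have k1 := pow_le_pow_left₀ (abs_nonneg _) h1 2
      have k2 := pow_le_pow_left₀ (abs_nonneg _) h4 2
      nlinarith [mul_pos hR hR']
    · have := hin (f x) hp (by linarith) (by linarith)
      rw [f.symm_apply_apply] at this
      exact dB_pos hΩ this
    · let w : E3 := mk3 (f x 0) (f x 1) (a (proj12 (f x)))
      have hw0 : proj12 w = proj12 (f x) := rfl
      have hw2 : w 2 = a (proj12 (f x)) := rfl
      have hwf : f.symm w ∈ frontier Ω := by
        rw [hgr w (by rw [hw0]; exact hp) (by rw [hw2]; exact ha'), hw0, hw2]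
      refine (Metric.infDist_le_dist_of_mem hwf).trans ?_
      have : dist x (f.symm w) = dist (f x) w := by
        rw [← f.dist_eq x, f.apply_symm_apply]
      rw [this, dist_eq_norm, EuclideanSpace.norm_eq, Fin.sum_univ_three]
      have z0 : (f x - w) 0 = 0 := sub_self (f x 0)
      have z1 : (f x - w) 1 = 0 := sub_self (f x 1)
      have z2 : (f x - w) 2 = f x 2 - a (proj12 (f x)) := rfl
      rw [z0, z1, z2]
      apply Real.sqrt_le_iff.mpr
      refine ⟨(hs0 k).le, ?_⟩
      rw [Real.norm_eq_abs, Real.norm_eq_abs, sq_abs, sq_abs]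
      nlinarith
  have hT : 0 < (R' / 2) ^ (β + 1) := by positivity
  have hS : ∀ k, ENNReal.ofReal ((R' / 2) ^ (β + 1) / 2 * (R * R))
      ≤ ∫⁻ x in S k, ENNReal.ofReal (dB Ω x ^ β) := by
    intro k
    calc _ ≤ ENNReal.ofReal (s k ^ β) * volume (S k) := by
          rw [hSv, ← ENNReal.ofReal_mul (by have := hs0 k; positivity)]
          apply ENNReal.ofReal_le_ofReal
          have h1 : (R' / 2) ^ (β + 1) ≤ s k ^ (β + 1) :=
            Real.rpow_le_rpow_of_nonpos (hs0 k) (hsle k) (by linarith)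
          rw [Real.rpow_add (hs0 k), Real.rpow_one] at h1
          have : 0 < R * R := by positivity
          nlinarith
      _ = ∫⁻ x in S k, ENNReal.ofReal (s k ^ β) := by rw [setLIntegral_const]
      _ ≤ _ := by
          refine setLIntegral_mono (((continuous_dB Ω).measurable.pow_const β).ennreal_ofReal)
            fun x hx => ENNReal.ofReal_le_ofReal ?_
          obtain ⟨-, h1, h2⟩ := hpt k x hx
          exact Real.rpow_le_rpow_of_nonpos h1 h2 (by linarith)
  rw [eq_top_iff]
  calc (∞ : ℝ≥0∞) = ∑' _ : ℕ, ENNReal.ofReal ((R' / 2) ^ (β + 1) / 2 * (R * R)) := by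
        rw [ENNReal.tsum_const_eq_top_of_ne_zero]
        have : 0 < (R' / 2) ^ (β + 1) / 2 * (R * R) := by positivity
        simpa using this
    _ ≤ ∑' k, ∫⁻ x in S k, ENNReal.ofReal (dB Ω x ^ β) := ENNReal.tsum_le_tsum hS
    _ = ∫⁻ x in ⋃ k, S k, ENNReal.ofReal (dB Ω x ^ β) := (lintegral_iUnion hSm hdis _).symm
    _ ≤ _ := lintegral_mono_set (Set.iUnion_subset fun k x hx => (hpt k x hx).1)

lemma range_of_muck {Ω : Set E3} (hΩ : IsLipschitzDomain Ω) {p α : ℝ} (hp : 1 < p)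
    (H : IsMuckenhouptAp (fun x => dB Ω x ^ α) p) : -1 < α ∧ α < p - 1 := by
  have hp1 : 0 < p - 1 := by linarith
  obtain ⟨C, hC⟩ := H
  obtain ⟨P, hP⟩ := frontier_nonempty hΩ
  have e : (fun x => (dB Ω x ^ α) ^ (-1 / (p - 1))) = fun x => dB Ω x ^ (α * (-1 / (p - 1))) := by
    funext x; rw [Real.rpow_mul (dB_nonneg Ω x)]
  rw [e] at hC
  have hv : ∀ h : ℝ, 0 < h → volume (cube P h) ≠ ∞ := fun h hh => by
    rw [volume_cube P hh]; exact ENNReal.ofReal_ne_top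
  have hpos : ∀ (β h : ℝ), 0 < h → lavg (cube P h) (fun x => dB Ω x ^ β) ≠ 0 := by
    intro β h hh
    exact (ENNReal.div_pos (lint_pos hΩ β hP hh).ne' (hv h hh)).ne'
  have htop : ∀ β ≤ (-1 : ℝ), ∃ h > 0, lavg (cube P h) (fun x => dB Ω x ^ β) = ∞ := by
    intro β hβ
    obtain ⟨h, hh, h1⟩ := lint_top hΩ hβ hP
    refine ⟨h, hh, ?_⟩
    unfold lavg
    rw [h1, ENNReal.top_div_of_ne_top (hv h hh)]
  by_contra hcon
  rw [not_and_or, not_lt, not_lt] at hcon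
  rcases hcon with h1 | h1
  · obtain ⟨h, hh, ht⟩ := htop α h1
    have := hC P h hh
    rw [ht, ENNReal.top_mul] at this
    · exact absurd this (by simp)
    · intro h0
      rw [ENNReal.rpow_eq_zero_iff] at h0
      rcases h0 with h0 | h0
      · exact hpos _ h hh h0.1
      · linarith [h0.2]
  · obtain ⟨h, hh, ht⟩ := htop (α * (-1 / (p - 1))) (by
      rw [mul_div_assoc', div_le_iff₀ hp1]; linarith)
    have := hC P h hh
    rw [ht, ENNReal.top_rpow_of_pos hp1, ENNReal.mul_top (hpos _ h hh)] at this
    exact absurd this (by simp)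

/-- The power of the distance to the boundary `d^α` is a Muckenhoupt
`A_p` weight if and only if `-1 < α < p - 1`. -/
theorem distance_power_muckenhoupt_iff
    (Ω : Set E3) (hΩ : IsLipschitzDomain Ω) (p α : ℝ) (hp : 1 < p) :
    IsMuckenhouptAp (fun x => dB Ω x ^ α) p ↔ (-1 < α ∧ α < p - 1) := by
  exact ⟨fun H => range_of_muck hΩ hp H, fun h => muck_of_range hΩ hp h.1 h.2⟩
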